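/- Let p be a prime and let G be an admissible nilpotent subgroup of GL₂(ℤ/pℤ), i.e., G satisfies: det(G) = (ℤ/pℤ)ˣ, and G contains a matrix of determinant −1 and trace 0 that fixes some nonzero vector of (ℤ/pℤ)². Then either G is abelian, or the image of G in PGL₂(ℤ/pℤ) (the quotient of GL₂(ℤ/pℤ) by its center) is isomorphic to a dihedral group of order 2^j for some j ≥ 2, where the Klein four-group counts as the dihedral group of order 4. Moreover, if p is odd, then G is conjugate in GL₂(ℤ/pℤ) to a subgroup of the normalizer of the split Cartan subgroup (the group of all invertible diagonal and antidiagonal matrices) or to a subgroup of the normalizer of the non-split Cartan subgroup (the group generated by all matrices [[a, εb],[b, a]] with (a,b) ≠ (0,0), where ε is a fixed non-square in (ℤ/pℤ)ˣ, together with the matrix [[1,0],[0,−1]]). -/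

import Mathlib

open Matrix

/-- The set of invertible diagonal and antidiagonal matrices in `GL₂(ℤ/pℤ)`: the normalizer
of the split Cartan subgroup. -/
def splitCartanNormalizer (p : ℕ) : Set (GL (Fin 2) (ZMod p)) :=
  {g | ((g : Matrix (Fin 2) (Fin 2) (ZMod p)) 0 1 = 0 ∧
          (g : Matrix (Fin 2) (Fin 2) (ZMod p)) 1 0 = 0) ∨
       ((g : Matrix (Fin 2) (Fin 2) (ZMod p)) 0 0 = 0 ∧
          (g : Matrix (Fin 2) (Fin 2) (ZMod p)) 1 1 = 0)}

/-- The normalizer of the non-split Cartan subgroup of `GL₂(ℤ/pℤ)` attached to a non-square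
`ε`: the subgroup generated by the matrices `[[a, εb], [b, a]]` with `(a, b) ≠ (0, 0)`,
together with `[[1, 0], [0, -1]]`. -/
def nonsplitCartanNormalizer (p : ℕ) (ε : ZMod p) : Subgroup (GL (Fin 2) (ZMod p)) :=
  Subgroup.closure
    ({g | ∃ a b : ZMod p, (a, b) ≠ (0, 0) ∧
        (g : Matrix (Fin 2) (Fin 2) (ZMod p)) = !![a, ε * b; b, a]} ∪
     {g | (g : Matrix (Fin 2) (Fin 2) (ZMod p)) = !![1, 0; 0, -1]})

open scoped commutatorElement

/-- A group generated by an element `r` and an involution `s ∉ ⟨r⟩` inverting `r` is dihedral. -/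
theorem nonempty_mulEquiv_dihedralGroup {H : Type*} [Group H] {r s : H} (hs : s * s = 1)
    (hsr : s * r * s⁻¹ = r⁻¹) (hsmem : s ∉ Subgroup.zpowers r)
    (hcover : ∀ h, h ∈ Subgroup.zpowers r ∨ s * h ∈ Subgroup.zpowers r) :
    Nonempty (H ≃* DihedralGroup (orderOf r)) := by
  have hconj (k : ℤ) : r ^ k * s = s * r ^ (-k) := by
    have h : s * r ^ k * s⁻¹ = r ^ (-k) := by rw [← conj_zpow, hsr, _root_.inv_zpow']
    rw [← h, ← mul_assoc, ← mul_assoc, hs, one_mul, inv_eq_of_mul_eq_one_right hs]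
  let φ : ZMod (orderOf r) →+ Additive H :=
    ZMod.lift (orderOf r) ⟨zmultiplesHom (Additive H) (Additive.ofMul r), by
      simp [← ofMul_pow, pow_orderOf_eq_one]⟩
  let ρ : ZMod (orderOf r) → H := fun i => (φ i).toMul
  have hρ_int (k : ℤ) : ρ k = r ^ k := by simp [ρ, φ]
  have hρ_add (i j) : ρ (i + j) = ρ i * ρ j := by simp [ρ]
  have hρ_sub (i j) : ρ (j - i) = ρ (-i) * ρ j := by rw [← hρ_add, neg_add_eq_sub]
  have hρ_swap (i) : ρ i * s = s * ρ (-i) := by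
    obtain ⟨k, rfl⟩ := ZMod.intCast_surjective i
    rw [← Int.cast_neg, hρ_int, hρ_int, hconj]
  have hρ_mem (i) : ρ i ∈ Subgroup.zpowers r := by
    obtain ⟨k, rfl⟩ := ZMod.intCast_surjective i
    exact ⟨k, (hρ_int k).symm⟩
  have hρ_surj {h} (hh : h ∈ Subgroup.zpowers r) : ∃ i, ρ i = h := by
    obtain ⟨k, rfl⟩ := hh
    exact ⟨k, hρ_int k⟩
  let f : DihedralGroup (orderOf r) → H
    | .r i => ρ i
    | .sr i => s * ρ i
  let F : DihedralGroup (orderOf r) →* H := MonoidHom.mk' f <| by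
    rintro (i | i) (j | j)
    · exact hρ_add i j
    · change s * ρ (j - i) = ρ i * (s * ρ j)
      rw [hρ_sub, ← mul_assoc, ← mul_assoc, hρ_swap]
    · change s * ρ (i + j) = s * ρ i * ρ j
      rw [hρ_add, mul_assoc]
    · change ρ (j - i) = s * ρ i * (s * ρ j)
      rw [hρ_sub, mul_assoc, ← mul_assoc (ρ i), hρ_swap, ← mul_assoc, ← mul_assoc, hs, one_mul]
  refine ⟨(MulEquiv.ofBijective F ⟨(injective_iff_map_eq_one F).2 ?_, fun h => ?_⟩).symm⟩
  · rintro (i | i) hi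
    · obtain ⟨k, rfl⟩ := ZMod.intCast_surjective i
      replace hi : r ^ k = 1 := (hρ_int k).symm.trans hi
      rw [(ZMod.intCast_zmod_eq_zero_iff_dvd k _).2 (orderOf_dvd_iff_zpow_eq_one.2 hi),
        DihedralGroup.r_zero]
    · replace hi : s * ρ i = 1 := hi
      exact absurd (eq_inv_of_mul_eq_one_left hi ▸ inv_mem (hρ_mem i)) hsmem
  · rcases hcover h with hh | hh
    · obtain ⟨i, hi⟩ := hρ_surj hh
      exact ⟨.r i, hi⟩
    · obtain ⟨i, hi⟩ := hρ_surj hh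
      refine ⟨.sr i, ?_⟩
      change s * ρ i = h
      rw [hi, ← mul_assoc, hs, one_mul]

/-- In a nilpotent group, an element inverted by some conjugation has `2`-power order. -/
theorem exists_two_pow_pow_eq_one_of_conj_eq_inv {H : Type*} [Group H] [hH : Group.IsNilpotent H] :
    ∃ k : ℕ, ∀ s x : H, s * x * s⁻¹ = x⁻¹ → x ^ 2 ^ k = 1 := by
  obtain ⟨n, hn⟩ := Subgroup.nilpotent_iff_lowerCentralSeries.1 hH
  refine ⟨n, fun s x hx => ?_⟩
  have key (k : ℕ) : x ^ 2 ^ k ∈ (⊤ : Subgroup H).lowerCentralSeries k := by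
    induction k with
    | zero => simp
    | succ k ih =>
      rw [Subgroup.lowerCentralSeries_succ]
      have h : ⁅x ^ 2 ^ k, s⁆ = x ^ 2 ^ (k + 1) := by
        have h₁ : s * (x ^ 2 ^ k)⁻¹ * s⁻¹ = x ^ 2 ^ k := by
          rw [← conj_inv, ← conj_pow, hx, inv_pow, inv_inv]
        rw [commutatorElement_def, mul_assoc, mul_assoc, ← mul_assoc s, h₁, ← pow_add, pow_succ,
          mul_two]
      exact h ▸ Subgroup.commutator_mem_commutator ih (Subgroup.mem_top s)
  simpa [hn] using key n

/-- In an abelian subgroup with at most one involution, a cyclic `2`-subgroup contains all elements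
killed by its order. -/
theorem mem_zpowers_of_pow_two_pow_eq_one {H : Type*} [Group H] {A : Subgroup H} {z : H}
    (hcomm : ∀ a ∈ A, ∀ b ∈ A, a * b = b * a) (hinvol : ∀ a ∈ A, a ^ 2 = 1 → a = 1 ∨ a = z)
    (k : ℕ) : ∀ r ∈ A, orderOf r = 2 ^ k → ∀ a ∈ A, a ^ 2 ^ k = 1 → a ∈ Subgroup.zpowers r := by
  induction k with
  | zero =>
    intro r _ _ a _ ha
    rw [pow_zero, pow_one] at ha
    exact ha ▸ one_mem _
  | succ k ih =>
    intro r hr hord a ha hak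
    have hord2 : orderOf (r ^ 2) = 2 ^ k := by
      rw [orderOf_pow_of_dvd two_ne_zero (hord ▸ dvd_pow_self 2 k.succ_ne_zero), hord, pow_succ,
        Nat.mul_div_cancel _ two_pos]
    obtain ⟨i, hi⟩ := ih (r ^ 2) (pow_mem hr 2) hord2 (a ^ 2) (pow_mem ha 2)
      (by rw [← pow_mul, ← pow_succ', hak])
    replace hi : (r ^ 2) ^ i = a ^ 2 := hi
    have hri : (r ^ i) ^ 2 = a ^ 2 := by rw [← hi, ← zpow_natCast, ← zpow_natCast, zpow_comm]
    have hz : r ^ 2 ^ k = z := by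
      refine (hinvol _ (pow_mem hr _) ?_).resolve_left fun h => ?_
      · rw [← pow_mul, ← pow_succ, ← hord, pow_orderOf_eq_one]
      · exact absurd (Nat.le_of_dvd (by positivity) (hord ▸ orderOf_dvd_of_pow_eq_one h))
          (by rw [pow_succ]; have := Nat.two_pow_pos k; omega)
    have hmem : a * (r ^ i)⁻¹ ∈ Subgroup.zpowers r := by
      have hc : Commute a (r ^ i)⁻¹ := hcomm _ ha _ (inv_mem (zpow_mem hr i))
      rcases hinvol _ (mul_mem ha (inv_mem (zpow_mem hr i)))
        (by rw [hc.mul_pow, inv_pow, hri, mul_inv_cancel]) with h | h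
      · exact h ▸ one_mem _
      · exact h ▸ hz ▸ Subgroup.npow_mem_zpowers r _
    simpa using mul_mem hmem (Subgroup.zpow_mem_zpowers r i)

/-- A nilpotent group with an abelian subgroup of index two, having a unique involution and
with all elements outside it involutions, is a dihedral `2`-group. -/
theorem exists_mulEquiv_dihedralGroup_two_pow {H : Type*} [Group H] [Group.IsNilpotent H]
    {A : Subgroup H} {z s : H} (hz : z ∈ A) (hz1 : z ≠ 1) (hs : s ∉ A)
    (hcomm : ∀ a ∈ A, ∀ b ∈ A, a * b = b * a) (hinvol : ∀ a ∈ A, a ^ 2 = 1 → a = 1 ∨ a = z)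
    (hindex : ∀ a ∉ A, ∀ b ∉ A, a * b ∈ A) (hout : ∀ a ∉ A, a * a = 1) :
    ∃ j : ℕ, 2 ≤ j ∧ Nonempty (H ≃* DihedralGroup (2 ^ (j - 1))) := by
  have hinv : ∀ a ∈ A, s * a * s⁻¹ = a⁻¹ := fun a ha => by
    have h := hout (s * a) fun h => hs <| by simpa using mul_mem h (inv_mem ha)
    rw [inv_eq_of_mul_eq_one_right (hout s hs)]
    exact eq_inv_of_mul_eq_one_left (by rw [← h]; group)
  obtain ⟨n, hn⟩ := exists_two_pow_pow_eq_one_of_conj_eq_inv (H := H)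
  have hex : ∃ k : ℕ, ∀ a ∈ A, a ^ 2 ^ k = 1 := ⟨n, fun a ha => hn s a (hinv a ha)⟩
  classical
  obtain ⟨m, hm⟩ : ∃ m, Nat.find hex = m + 1 := by
    refine Nat.exists_eq_succ_of_ne_zero fun h => hz1 ?_
    simpa [h] using Nat.find_spec hex z hz
  obtain ⟨r, hr, hrm⟩ : ∃ r ∈ A, ¬ r ^ 2 ^ m = 1 := by
    simpa using Nat.find_min hex (m := m) (by omega)
  have hpow : ∀ a ∈ A, a ^ 2 ^ (m + 1) = 1 := hm ▸ Nat.find_spec hex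
  have hord : orderOf r = 2 ^ (m + 1) := orderOf_eq_prime_pow hrm (hpow r hr)
  have hA : ∀ a ∈ A, a ∈ Subgroup.zpowers r := fun a ha =>
    mem_zpowers_of_pow_two_pow_eq_one hcomm hinvol _ r hr hord a ha (hpow a ha)
  refine ⟨m + 2, by omega, ?_⟩
  have h := nonempty_mulEquiv_dihedralGroup (hout s hs) (hinv r hr)
    (fun h => hs (Subgroup.zpowers_le.2 hr h))
    (fun h => (em (h ∈ A)).imp (hA h) fun hh => hA _ (hindex s hs h hh))
  rwa [hord] at h

/-- A nonabelian nilpotent group has a non-central element that is central modulo the center. -/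
theorem exists_notMem_center_of_isNilpotent {G : Type*} [Group G] [hG : Group.IsNilpotent G]
    (hna : ¬ ∀ a b : G, a * b = b * a) :
    ∃ z ∉ Subgroup.center G, ∀ g : G, z * g * z⁻¹ * g⁻¹ ∈ Subgroup.center G := by
  by_contra! hcon
  obtain ⟨n, hn⟩ := hG.nilpotent
  have hle (k : ℕ) : Subgroup.upperCentralSeries G k ≤ Subgroup.center G := by
    induction k with
    | zero => simp
    | succ k ih =>
      intro x hx
      by_contra hxc
      obtain ⟨g, hg⟩ := hcon x hxc
      exact hg (ih (hx g))
  refine hna fun a b => ?_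
  exact (Subgroup.mem_center_iff.1 (hle n (hn ▸ Subgroup.mem_top b)) a)

namespace Matrix.GeneralLinearGroup

variable {K : Type*} [Field K]

theorem mem_center_fin_two_iff {z : GL (Fin 2) K} :
    z ∈ Subgroup.center (GL (Fin 2) K) ↔ z 0 1 = 0 ∧ z 1 0 = 0 ∧ z 0 0 = z 1 1 := by
  rw [mem_center_iff_val_mem_range_scalar]
  constructor
  · rintro ⟨c, hc⟩
    simp [← hc]
  · rintro ⟨h₁, h₂, h₃⟩
    refine ⟨z 0 0, ?_⟩
    ext i j
    fin_cases i <;> fin_cases j <;> simp [h₁, h₂, h₃]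

/-- A matrix commuting with a non-scalar `2 × 2` matrix is a linear polynomial in it. -/
theorem exists_eq_smul_one_add_smul {z x : GL (Fin 2) K}
    (hz : z ∉ Subgroup.center (GL (Fin 2) K)) (h : z * x = x * z) :
    ∃ a b : K, x.val = a • (1 : Matrix (Fin 2) (Fin 2) K) + b • z.val := by
  have hm : z.val * x.val = x.val * z.val := congrArg Units.val h
  have h00 := congrFun₂ hm 0 0
  have h01 := congrFun₂ hm 0 1
  have h10 := congrFun₂ hm 1 0
  simp only [mul_apply, Fin.sum_univ_two] at h00 h01 h10
  by_cases hz01 : z 0 1 = 0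
  · by_cases hz10 : z 1 0 = 0
    · have hne : z 0 0 - z 1 1 ≠ 0 := sub_ne_zero.2 <| by
        simpa [mem_center_fin_two_iff, hz01, hz10] using hz
      have hx01 : x 0 1 = 0 := by
        refine (mul_eq_zero.1 ?_).resolve_left hne
        linear_combination h01 + (x 0 0 - x 1 1) * hz01
      have hx10 : x 1 0 = 0 := by
        refine (mul_eq_zero.1 ?_).resolve_left hne
        linear_combination -h10 + (x 0 0 - x 1 1) * hz10
      refine ⟨x 0 0 - (x 0 0 - x 1 1) / (z 0 0 - z 1 1) * z 0 0,
        (x 0 0 - x 1 1) / (z 0 0 - z 1 1), ?_⟩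
      ext i j
      fin_cases i <;> fin_cases j <;> simp [hz01, hz10, hx01, hx10]
      field_simp
      ring
    · refine ⟨x 0 0 - x 1 0 / z 1 0 * z 0 0, x 1 0 / z 1 0, ?_⟩
      ext i j
      fin_cases i <;> fin_cases j <;> simp <;> field_simp
      · linear_combination -h00
      · linear_combination -h10
  · refine ⟨x 0 0 - x 0 1 / z 0 1 * z 0 0, x 0 1 / z 0 1, ?_⟩
    ext i j
    fin_cases i <;> fin_cases j <;> simp <;> field_simp
    · linear_combination h00
    · linear_combination h01

theorem commute_of_commute {z x y : GL (Fin 2) K} (hz : z ∉ Subgroup.center (GL (Fin 2) K))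
    (hx : z * x = x * z) (hy : z * y = y * z) : x * y = y * x := by
  obtain ⟨a, b, hab⟩ := exists_eq_smul_one_add_smul hz hx
  obtain ⟨c, d, hcd⟩ := exists_eq_smul_one_add_smul hz hy
  refine Units.ext ?_
  simp only [Units.val_mul, hab, hcd, add_mul, mul_add, smul_mul_smul_comm, one_mul, mul_one,
    mul_comm a, mul_comm b]
  abel

theorem eq_or_eq_neg_of_mem_center {z g : GL (Fin 2) K}
    (h : z * g * z⁻¹ * g⁻¹ ∈ Subgroup.center (GL (Fin 2) K)) : z * g = g * z ∨ z * g = -(g * z) := by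
  rw [center_eq_range_scalar] at h
  obtain ⟨u, hu⟩ := h
  have hdet : u ^ 2 = 1 := by
    have := congrArg det hu
    rw [det_scalar, Fintype.card_fin] at this
    simpa only [map_mul, map_inv, mul_inv_cancel_comm, mul_inv_cancel] using this
  have hzg : z * g = scalar (Fin 2) u * (g * z) := by rw [hu]; group
  rcases Units.eq_or_eq_neg_of_sq_eq_sq u 1 (by rw [hdet, one_pow]) with rfl | rfl
  · exact .inl (by simpa using hzg)
  · have hneg : scalar (Fin 2) (-1 : Kˣ) = -1 := by
      refine Units.ext ?_
      rw [coe_scalar, Units.val_neg, Units.val_one, map_neg, map_one, Units.val_neg, Units.val_one]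
    exact .inr (by rw [hzg, hneg, neg_one_mul])

theorem two_ne_zero_of_eq_neg {z g : GL (Fin 2) K} (h : z * g = -(g * z)) (hne : z * g ≠ g * z) :
    (2 : K) ≠ 0 := by
  intro h2
  refine hne (h.trans <| Units.ext <| ?_)
  have : CharP K 2 := CharTwo.of_one_ne_zero_of_two_eq_zero one_ne_zero h2
  ext i j
  simp [CharTwo.neg_eq]

theorem trace_eq_zero_of_eq_neg (h2 : (2 : K) ≠ 0) {z g : GL (Fin 2) K} (h : z * g = -(g * z)) :
    z.val.trace = 0 := by
  have h1 : z.val = -(g.val * z.val * (g⁻¹).val) := by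
    have : z = -(g * z * g⁻¹) := by rw [← neg_mul, ← h]; group
    simpa using congrArg Units.val this
  have h3 := congrArg trace h1
  rw [trace_neg, trace_mul_cycle, ← Units.val_mul, inv_mul_cancel, Units.val_one, one_mul] at h3
  have : 2 * z.val.trace = 0 := by linear_combination h3
  simpa [h2] using this

theorem mul_self_eq_of_trace_eq_zero {R : Type*} [CommRing R] {x : Matrix (Fin 2) (Fin 2) R}
    (h : x.trace = 0) : x * x = (-x.det) • 1 := by
  rw [trace_fin_two] at h
  ext i j
  fin_cases i <;> fin_cases j <;> simp [mul_apply, det_fin_two, Fin.sum_univ_two]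
  · linear_combination x 0 0 * h
  · linear_combination x 0 1 * h
  · linear_combination x 1 0 * h
  · linear_combination x 1 1 * h

theorem mem_center_of_val_eq_smul {x : GL (Fin 2) K} {c : K} (h : x.val = c • 1) :
    x ∈ Subgroup.center (GL (Fin 2) K) :=
  mem_center_iff_val_mem_range_scalar.2 ⟨c, by rw [h, scalar_apply, smul_one_eq_diagonal]⟩

theorem mul_self_mem_center {x : GL (Fin 2) K} (h : x.val.trace = 0) :
    x * x ∈ Subgroup.center (GL (Fin 2) K) :=
  mem_center_of_val_eq_smul (mul_self_eq_of_trace_eq_zero h)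

theorem mem_center_or_mul_inv_mem_center (h2 : (2 : K) ≠ 0) {z x : GL (Fin 2) K}
    (hz : z ∉ Subgroup.center (GL (Fin 2) K)) (htr : z.val.trace = 0) (h : z * x = x * z)
    (hx : x * x ∈ Subgroup.center (GL (Fin 2) K)) :
    x ∈ Subgroup.center (GL (Fin 2) K) ∨ x * z⁻¹ ∈ Subgroup.center (GL (Fin 2) K) := by
  obtain ⟨a, b, hab⟩ := exists_eq_smul_one_add_smul hz h
  by_cases hb : b = 0
  · exact .inl (mem_center_of_val_eq_smul (c := a) (by simp [hab, hb]))
  by_cases ha : a = 0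
  · exact .inr (mem_center_of_val_eq_smul (c := b) (by
      rw [Units.val_mul, hab, ha, zero_smul, zero_add, smul_mul_assoc, Units.mul_inv]))
  refine absurd ?_ hz
  obtain ⟨c, hc⟩ := mem_center_iff_val_mem_range_scalar.1 hx
  refine mem_center_of_val_eq_smul (c := (2 * a * b)⁻¹ * (c - a ^ 2 + b ^ 2 * z.val.det)) ?_
  have hab0 : 2 * a * b ≠ 0 := by simp [h2, ha, hb]
  rw [mul_smul, eq_inv_smul_iff₀ hab0]
  rw [Units.val_mul, hab, scalar_apply, ← smul_one_eq_diagonal] at hc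
  simp only [add_mul, mul_add, smul_mul_smul_comm, one_mul, mul_one,
    mul_self_eq_of_trace_eq_zero htr] at hc
  ext i j
  have hij := congrFun₂ hc i j
  simp only [add_apply, smul_apply, smul_eq_mul] at hij ⊢
  linear_combination -hij

/-- Non-scalar matrices of trace zero are determined up to conjugation by their determinant. -/
theorem exists_mul_eq_companion {z : GL (Fin 2) K}
    (hz : z ∉ Subgroup.center (GL (Fin 2) K)) (htr : z.val.trace = 0) :
    ∃ h : GL (Fin 2) K, z.val * h.val = h.val * !![0, -z.val.det; 1, 0] := by
  have h11 : z 1 1 = - z 0 0 := by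
    rw [trace_fin_two] at htr
    linear_combination htr
  suffices ∃ v : Fin 2 → K, v 0 * (z.val *ᵥ v) 1 - v 1 * (z.val *ᵥ v) 0 ≠ 0 by
    obtain ⟨v, hv⟩ := this
    refine ⟨mkOfDetNeZero !![v 0, (z.val *ᵥ v) 0; v 1, (z.val *ᵥ v) 1] ?_, ?_⟩
    · rw [det_fin_two_of]
      convert hv using 1
      ring
    · ext i j
      fin_cases i <;> fin_cases j <;>
        simp [mkOfDetNeZero, mul_apply, mulVec, dotProduct, Fin.sum_univ_two, det_fin_two, h11] <;>
        ring
  by_cases h01 : z 0 1 = 0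
  · by_cases h10 : z 1 0 = 0
    · have hne : z 0 0 ≠ z 1 1 := by
        simpa [mem_center_fin_two_iff, h01, h10] using hz
      refine ⟨![1, 1], ?_⟩
      simpa [mulVec, dotProduct, Fin.sum_univ_two, h01, h10, sub_eq_zero] using hne.symm
    · exact ⟨![1, 0], by simpa [mulVec, dotProduct, Fin.sum_univ_two] using h10⟩
  · exact ⟨![0, 1], by simpa [mulVec, dotProduct, Fin.sum_univ_two] using h01⟩

/-- Non-scalar matrices of trace zero and equal determinant are conjugate. -/
theorem exists_mul_eq_mul_of_det_eq {z w : GL (Fin 2) K}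
    (hz : z ∉ Subgroup.center (GL (Fin 2) K)) (hw : w ∉ Subgroup.center (GL (Fin 2) K))
    (htz : z.val.trace = 0) (htw : w.val.trace = 0) (hdet : z.val.det = w.val.det) :
    ∃ h : GL (Fin 2) K, h * z = w * h := by
  obtain ⟨h, hh⟩ := exists_mul_eq_companion hz htz
  obtain ⟨k, hk⟩ := exists_mul_eq_companion hw htw
  refine ⟨k * h⁻¹, ?_⟩
  have hz' : (h⁻¹).val * z.val = !![0, -z.val.det; 1, 0] * (h⁻¹).val := by
    rw [← Units.mul_left_inj h, mul_assoc, hh, mul_assoc, Units.inv_mul, Units.inv_mul_cancel_left,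
      mul_one]
  refine Units.ext ?_
  simp only [Units.val_mul]
  rw [mul_assoc, hz', hdet, ← mul_assoc, ← hk, mul_assoc]

/-- A nonabelian nilpotent subgroup of `GL₂` contains a trace zero element with which each of its
elements commutes or anticommutes. -/
theorem exists_commute_or_anticommute {G : Subgroup (GL (Fin 2) K)} [Group.IsNilpotent G]
    (hna : ¬ ∀ a ∈ G, ∀ b ∈ G, a * b = b * a) :
    (2 : K) ≠ 0 ∧ ∃ z ∈ G, z ∉ Subgroup.center (GL (Fin 2) K) ∧ z.val.trace = 0 ∧
      (∃ s ∈ G, z * s ≠ s * z) ∧ ∀ g ∈ G, z * g = g * z ∨ z * g = -(g * z) := by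
  have hcenter (c : G) (hc : c ∈ Subgroup.center G) : (c : GL (Fin 2) K) ∈ Subgroup.center _ := by
    by_contra hcz
    have hcomm (a) (ha : a ∈ G) : (c : GL (Fin 2) K) * a = a * c :=
      congrArg Subtype.val (Subgroup.mem_center_iff.1 hc ⟨a, ha⟩).symm
    exact hna fun a ha b hb => commute_of_commute hcz (hcomm a ha) (hcomm b hb)
  obtain ⟨z, hz, hzG⟩ := exists_notMem_center_of_isNilpotent (G := G) fun h =>
    hna fun a ha b hb => congrArg Subtype.val (h ⟨a, ha⟩ ⟨b, hb⟩)
  have hor (g) (hg : g ∈ G) : (z : GL (Fin 2) K) * g = g * z ∨ (z : GL (Fin 2) K) * g = -(g * z) :=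
    eq_or_eq_neg_of_mem_center (hcenter _ (hzG ⟨g, hg⟩))
  obtain ⟨s, hs⟩ : ∃ s, z * s ≠ s * z := by
    by_contra! h
    exact hz (Subgroup.mem_center_iff.2 fun g => (h g).symm)
  have hs' : (z : GL (Fin 2) K) * s ≠ s * z := fun h => hs (Subtype.ext h)
  have hneg := (hor s s.2).resolve_left hs'
  have h2 := two_ne_zero_of_eq_neg hneg hs'
  refine ⟨h2, z, z.2, fun h => hs' ?_, trace_eq_zero_of_eq_neg h2 hneg, ⟨s, s.2, hs'⟩, hor⟩
  exact (Subgroup.mem_center_iff.1 h s).symm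

/-- The projective image of a nonabelian nilpotent subgroup of `GL₂` is a dihedral `2`-group. -/
theorem exists_map_center_mulEquiv_dihedralGroup {G : Subgroup (GL (Fin 2) K)}
    [Group.IsNilpotent G] (hna : ¬ ∀ a ∈ G, ∀ b ∈ G, a * b = b * a) :
    ∃ j : ℕ, 2 ≤ j ∧ Nonempty (↥(G.map (QuotientGroup.mk' (Subgroup.center (GL (Fin 2) K)))) ≃*
      DihedralGroup (2 ^ (j - 1))) := by
  obtain ⟨h2, z, hzG, hz, htr, ⟨s, hsG, hs⟩, hor⟩ := exists_commute_or_anticommute hna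
  let f := (QuotientGroup.mk' (Subgroup.center (GL (Fin 2) K))).subgroupMap G
  have hf : Function.Surjective f := MonoidHom.subgroupMap_surjective _ G
  have hf1 (g : G) : f g = 1 ↔ (g : GL (Fin 2) K) ∈ Subgroup.center (GL (Fin 2) K) := by
    rw [Subtype.ext_iff]
    exact QuotientGroup.eq_one_iff _
  have := Group.nilpotent_of_surjective f hf
  let A := (Subgroup.centralizer {(⟨z, hzG⟩ : G)}).map f
  have hmem (g : G) : f g ∈ A ↔ z * g = g * z := by
    constructor
    · rintro ⟨x, hx, hxg⟩
      have hxz : z * x = x * z :=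
        congrArg Subtype.val (Subgroup.mem_centralizer_singleton_iff.1 hx).symm
      have hc : ((x⁻¹ * g : G) : GL (Fin 2) K) ∈ Subgroup.center (GL (Fin 2) K) := by
        rw [← hf1, map_mul, map_inv, hxg, inv_mul_cancel]
      have hgx : (g : GL (Fin 2) K) = x * (x⁻¹ * g : G) := by simp
      rw [hgx, ← mul_assoc, hxz, mul_assoc, Subgroup.mem_center_iff.1 hc z, mul_assoc]
    · intro h
      exact ⟨g, Subgroup.mem_centralizer_singleton_iff.2 (Subtype.ext h.symm), rfl⟩
  have hneg (g : G) (hg : f g ∉ A) : z * g = -(g * z) :=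
    (hor g g.2).resolve_left fun h => hg ((hmem g).2 h)
  refine exists_mulEquiv_dihedralGroup_two_pow (A := A) (z := f ⟨z, hzG⟩) (s := f ⟨s, hsG⟩)
    ((hmem _).2 rfl) (fun h => hz ((hf1 _).1 h)) (fun h => hs ((hmem _).1 h)) ?_ ?_ ?_ ?_
  · intro a ha b hb
    obtain ⟨a, rfl⟩ := hf a
    obtain ⟨b, rfl⟩ := hf b
    rw [← map_mul, ← map_mul]
    exact congrArg f (Subtype.ext (commute_of_commute hz ((hmem a).1 ha) ((hmem b).1 hb)))
  · intro a ha hsq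
    obtain ⟨a, rfl⟩ := hf a
    rw [pow_two, ← map_mul, hf1] at hsq
    refine (mem_center_or_mul_inv_mem_center h2 hz htr ((hmem a).1 ha) hsq).imp (hf1 a).2 fun h => ?_
    rw [← mul_inv_eq_one, ← map_inv, ← map_mul]
    exact (hf1 _).2 h
  · intro a ha b hb
    obtain ⟨a, rfl⟩ := hf a
    obtain ⟨b, rfl⟩ := hf b
    rw [← map_mul, hmem, Subgroup.coe_mul, ← mul_assoc, hneg a ha, neg_mul, mul_assoc, hneg b hb,
      mul_neg, neg_neg, mul_assoc]
  · intro a ha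
    obtain ⟨a, rfl⟩ := hf a
    rw [← map_mul, hf1]
    refine mul_self_mem_center (trace_eq_zero_of_eq_neg h2 (g := z) ?_)
    rw [hneg a ha, neg_neg]

end Matrix.GeneralLinearGroup

open Matrix.GeneralLinearGroup

theorem mem_splitCartanNormalizer_of_commute_or_anticommute {p : ℕ} [Fact p.Prime]
    (h2 : (2 : ZMod p) ≠ 0) {d : ZMod p} (hd : d ≠ 0) {w k : GL (Fin 2) (ZMod p)}
    (hw : w.val = !![d, 0; 0, -d]) (h : w * k = k * w ∨ w * k = -(k * w)) :
    k ∈ splitCartanNormalizer p := by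
  have hd2 : 2 * d ≠ 0 := mul_ne_zero h2 hd
  rcases h with h | h
  · replace h : w.val * k.val = k.val * w.val := congrArg Units.val h
    rw [hw] at h
    have h01 := congrFun₂ h 0 1
    have h10 := congrFun₂ h 1 0
    simp [mul_apply, Fin.sum_univ_two] at h01 h10
    refine .inl ⟨(mul_eq_zero.1 ?_).resolve_left hd2, (mul_eq_zero.1 ?_).resolve_left hd2⟩
    · linear_combination h01
    · linear_combination -h10
  · replace h : w.val * k.val = -(k.val * w.val) := congrArg Units.val h
    rw [hw] at h
    have h00 := congrFun₂ h 0 0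
    have h11 := congrFun₂ h 1 1
    simp [mul_apply, Fin.sum_univ_two] at h00 h11
    refine .inr ⟨(mul_eq_zero.1 ?_).resolve_left hd2, (mul_eq_zero.1 ?_).resolve_left hd2⟩
    · linear_combination h00
    · linear_combination -h11

theorem mem_nonsplitCartanNormalizer_of_commute {p : ℕ} [Fact p.Prime] {ε t : ZMod p} (ht : t ≠ 0)
    {w k : GL (Fin 2) (ZMod p)} (hw : w.val = !![0, ε * t; t, 0]) (h : w * k = k * w) :
    k ∈ nonsplitCartanNormalizer p ε := by
  replace h : w.val * k.val = k.val * w.val := congrArg Units.val h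
  rw [hw] at h
  have h00 := congrFun₂ h 0 0
  have h10 := congrFun₂ h 1 0
  simp [mul_apply, Fin.sum_univ_two] at h00 h10
  have h11 : k 1 1 = k 0 0 := mul_left_cancel₀ ht (by linear_combination -h10)
  have h01 : k 0 1 = ε * k 1 0 := mul_left_cancel₀ ht (by linear_combination -h00)
  refine Subgroup.subset_closure (.inl ⟨k 0 0, k 1 0, fun h0 => ?_, ?_⟩)
  · obtain ⟨h₁, h₂⟩ := Prod.mk.inj h0
    have := k.det_ne_zero
    rw [det_fin_two] at this
    simp [h₁, h₂] at this
  · ext i j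
    fin_cases i <;> fin_cases j <;> simp [h11, h01]

theorem mem_nonsplitCartanNormalizer_of_commute_or_anticommute {p : ℕ} [Fact p.Prime]
    {ε t : ZMod p} (ht : t ≠ 0) {w k : GL (Fin 2) (ZMod p)} (hw : w.val = !![0, ε * t; t, 0])
    (h : w * k = k * w ∨ w * k = -(k * w)) : k ∈ nonsplitCartanNormalizer p ε := by
  rcases h with h | h
  · exact mem_nonsplitCartanNormalizer_of_commute ht hw h
  let D : GL (Fin 2) (ZMod p) := mkOfDetNeZero !![1, 0; 0, -1] (by simp)
  have hD : D ∈ nonsplitCartanNormalizer p ε := Subgroup.subset_closure (.inr rfl)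
  have hwD : w * D = -(D * w) := by
    refine Units.ext ?_
    simp [D, mkOfDetNeZero, hw]
  refine (Subgroup.mul_mem_cancel_right _ hD).1 (mem_nonsplitCartanNormalizer_of_commute ht hw ?_)
  rw [← mul_assoc, h, neg_mul, mul_assoc, hwD, mul_neg, neg_neg, mul_assoc]

theorem conj_commute_or_anticommute {n R : Type*} [Fintype n] [DecidableEq n] [CommRing R]
    {h z w g : GL n R} (hh : h * z = w * h) (hg : z * g = g * z ∨ z * g = -(g * z)) :
    w * (h * g * h⁻¹) = h * g * h⁻¹ * w ∨ w * (h * g * h⁻¹) = -(h * g * h⁻¹ * w) := by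
  obtain rfl : w = h * z * h⁻¹ := by rw [hh, mul_inv_cancel_right]
  have h₁ : h * z * h⁻¹ * (h * g * h⁻¹) = h * (z * g) * h⁻¹ := by group
  have h₂ : h * g * h⁻¹ * (h * z * h⁻¹) = h * (g * z) * h⁻¹ := by group
  rw [h₁, h₂]
  rcases hg with hg | hg
  · exact .inl (by rw [hg])
  · exact .inr (by rw [hg, mul_neg, neg_mul])

/-- A subgroup each of whose elements commutes or anticommutes with a non-scalar matrix of trace
zero is conjugate into a Cartan normalizer. -/
theorem exists_conj_mem_cartanNormalizer {p : ℕ} [Fact p.Prime] (h2 : (2 : ZMod p) ≠ 0)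
    {G : Subgroup (GL (Fin 2) (ZMod p))} {z : GL (Fin 2) (ZMod p)}
    (hz : z ∉ Subgroup.center (GL (Fin 2) (ZMod p))) (htr : z.val.trace = 0)
    (hor : ∀ g ∈ G, z * g = g * z ∨ z * g = -(g * z)) :
    (∃ h : GL (Fin 2) (ZMod p), ∀ g ∈ G, h * g * h⁻¹ ∈ splitCartanNormalizer p) ∨
      ∀ ε : ZMod p, ¬ IsSquare ε →
        ∃ h : GL (Fin 2) (ZMod p), ∀ g ∈ G, h * g * h⁻¹ ∈ nonsplitCartanNormalizer p ε := by
  have hdet0 : -z.val.det ≠ 0 := neg_ne_zero.2 z.det_ne_zero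
  by_cases hsq : IsSquare (-z.val.det)
  · obtain ⟨d, hd⟩ := hsq
    have hd0 : d ≠ 0 := by
      rintro rfl
      exact hdet0 (by simpa using hd)
    let w : GL (Fin 2) (ZMod p) := mkOfDetNeZero !![d, 0; 0, -d] (by simp [hd0])
    obtain ⟨h, hh⟩ := exists_mul_eq_mul_of_det_eq hz (w := w)
      (fun hw => mul_ne_zero h2 hd0 <| by
        have := (mem_center_fin_two_iff.1 hw).2.2
        simp [w, mkOfDetNeZero] at this
        linear_combination this)
      htr (by simp [w, mkOfDetNeZero])
      (by
        rw [show w.val = !![d, 0; 0, -d] from rfl, det_fin_two_of]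
        linear_combination -hd)
    exact .inl ⟨h, fun g hg => mem_splitCartanNormalizer_of_commute_or_anticommute h2 hd0 rfl
      (conj_commute_or_anticommute hh (hor g hg))⟩
  · refine .inr fun ε hε => ?_
    have hε0 : ε ≠ 0 := fun h => hε (h ▸ IsSquare.zero)
    obtain ⟨r, hr⟩ : IsSquare (-z.val.det * ε) := by
      rw [← quadraticChar_one_iff_isSquare (mul_ne_zero hdet0 hε0), map_mul,
        quadraticChar_neg_one_iff_not_isSquare.2 hsq, quadraticChar_neg_one_iff_not_isSquare.2 hε,
        neg_one_mul, neg_neg]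
    have hr0 : r ≠ 0 := by
      rintro rfl
      exact mul_ne_zero hdet0 hε0 (by simpa using hr)
    have ht : r / ε ≠ 0 := div_ne_zero hr0 hε0
    let w : GL (Fin 2) (ZMod p) := mkOfDetNeZero !![0, ε * (r / ε); r / ε, 0] (by simp [hε0, hr0])
    obtain ⟨h, hh⟩ := exists_mul_eq_mul_of_det_eq hz (w := w)
      (fun hw => ht (mem_center_fin_two_iff.1 hw).2.1) htr (by simp [w, mkOfDetNeZero])
      (by
        rw [show w.val = !![0, ε * (r / ε); r / ε, 0] from rfl, det_fin_two_of]
        field_simp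
        linear_combination -hr)
    exact ⟨h, fun g hg => mem_nonsplitCartanNormalizer_of_commute_or_anticommute ht rfl
      (conj_commute_or_anticommute hh (hor g hg))⟩

/-- **Nilpotent admissible subgroups of `GL₂(ℤ/pℤ)`.** Let `G` be an admissible nilpotent
subgroup of `GL₂(ℤ/pℤ)`, i.e. `det(G) = (ℤ/pℤ)ˣ` and `G` contains a matrix of determinant
`-1` and trace `0` fixing a nonzero vector. Then `G` is abelian, or the image of `G` in
`PGL₂(ℤ/pℤ)` is isomorphic to a dihedral group of order `2^j` with `j ≥ 2` (Mathlib's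
`DihedralGroup m` has order `2m`, and `DihedralGroup 2` is the Klein four-group). Moreover,
if `p` is odd then `G` is conjugate to a subgroup of the normalizer of the split Cartan
subgroup or of the normalizer of a non-split Cartan subgroup. -/
theorem nilpotent_admissible_subgroup_GL2 (p : ℕ) (hp : p.Prime)
    (G : Subgroup (GL (Fin 2) (ZMod p)))
    (hnil : Group.IsNilpotent G)
    (hdet : ∀ u : (ZMod p)ˣ, ∃ g ∈ G, Matrix.GeneralLinearGroup.det g = u)
    (hadm : ∃ g ∈ G, (g : Matrix (Fin 2) (Fin 2) (ZMod p)).det = -1 ∧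
      Matrix.trace (g : Matrix (Fin 2) (Fin 2) (ZMod p)) = 0 ∧
      ∃ v : Fin 2 → ZMod p, v ≠ 0 ∧
        Matrix.mulVec (g : Matrix (Fin 2) (Fin 2) (ZMod p)) v = v) :
    ((∀ a ∈ G, ∀ b ∈ G, a * b = b * a) ∨
      ∃ j : ℕ, 2 ≤ j ∧
        Nonempty
          (↥(G.map (QuotientGroup.mk' (Subgroup.center (GL (Fin 2) (ZMod p))))) ≃*
            DihedralGroup (2 ^ (j - 1)))) ∧
      (Odd p →
        (∃ h : GL (Fin 2) (ZMod p), ∀ g ∈ G, h * g * h⁻¹ ∈ splitCartanNormalizer p) ∨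
          (∀ ε : ZMod p, ¬ IsSquare ε →
            ∃ h : GL (Fin 2) (ZMod p), ∀ g ∈ G,
              h * g * h⁻¹ ∈ nonsplitCartanNormalizer p ε)) := by
  have : Fact p.Prime := ⟨hp⟩
  refine ⟨or_iff_not_imp_left.2 exists_map_center_mulEquiv_dihedralGroup, fun hodd => ?_⟩
  by_cases hab : ∀ a ∈ G, ∀ b ∈ G, a * b = b * a
  · have h2 : (2 : ZMod p) ≠ 0 := Ring.two_ne_zero <| by
      rw [ZMod.ringChar_zmod_n]
      rintro rfl
      exact absurd hodd (by decide)
    obtain ⟨c, hcG, hdetc, htrc, -⟩ := hadm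
    refine exists_conj_mem_cartanNormalizer h2 (z := c) (fun hc => ?_) htrc
      fun g hg => .inl (hab c hcG g hg)
    obtain ⟨h01, -, h00⟩ := mem_center_fin_two_iff.1 hc
    rw [trace_fin_two, h00, ← two_mul] at htrc
    have h11 : c 1 1 = 0 := (mul_eq_zero.1 htrc).resolve_left h2
    simp [det_fin_two, h01, h11] at hdetc
  · obtain ⟨h2, z, -, hz, htr, -, hor⟩ := exists_commute_or_anticommute hab
    exact exists_conj_mem_cartanNormalizer h2 hz htr hor
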